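/- Assume that for every t, every i and every x ∈ X_i: (a) for μ-almost every ω the admissible set A_t^i(x, w_i(ω), z(ω)) is nonempty and the function u ↦ C_t^i(x, u, w_i(ω), z(ω)) + V_{t+1}^i(f_t^i(x, u, w_i(ω), z(ω))) is bounded below on it, and (b) the function ω ↦ inf{ C_t^i(x, u, w_i(ω), z(ω)) + V_{t+1}^i(f_t^i(x, u, w_i(ω), z(ω))) : u ∈ A_t^i(x, w_i(ω), z(ω)) } is μ-integrable. Then the global Bellman functions are additive: for every t = 0, …, T and every x = (x_1, …, x_N), V_t(x) = Σ_{i=1}^N V_t^i(x_i). -/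

import Mathlib

open MeasureTheory

/-- The infimum of a separable sum over a product of nonempty sets is the sum of the infima. -/
theorem sInf_image_univ_pi_sum {ι : Type*} [Fintype ι] {U : ι → Type*} (g : (i : ι) → U i → ℝ)
    (S : (i : ι) → Set (U i)) (hne : ∀ i, (S i).Nonempty) (hb : ∀ i, BddBelow (g i '' S i)) :
    sInf ((fun u : (i : ι) → U i => ∑ i, g i (u i)) '' Set.pi Set.univ S) =
      ∑ i, sInf (g i '' S i) := by
  have lower : ∀ b ∈ (fun u : (i : ι) → U i => ∑ i, g i (u i)) '' Set.pi Set.univ S,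
      ∑ i, sInf (g i '' S i) ≤ b := by
    rintro _ ⟨u, hu, rfl⟩
    exact Finset.sum_le_sum fun i _ => csInf_le (hb i) ⟨u i, hu i trivial, rfl⟩
  refine le_antisymm (le_of_forall_pos_le_add fun ε hε => ?_)
    (le_csInf ((Set.univ_pi_nonempty_iff.2 hne).image _) lower)
  have hδ : 0 < ε / (Fintype.card ι + 1) := by positivity
  have near : ∀ i, ∃ u ∈ S i, g i u < sInf (g i '' S i) + ε / (Fintype.card ι + 1) := fun i => by
    obtain ⟨_, ⟨u, hu, rfl⟩, h⟩ := Real.lt_sInf_add_pos ((hne i).image (g i)) hδ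
    exact ⟨u, hu, h⟩
  choose u hu hlt using near
  calc _ ≤ ∑ i, g i (u i) := csInf_le ⟨_, lower⟩ ⟨u, fun i _ => hu i, rfl⟩
    _ ≤ ∑ i, (sInf (g i '' S i) + ε / (Fintype.card ι + 1)) :=
      Finset.sum_le_sum fun i _ => (hlt i).le
    _ = ∑ i, sInf (g i '' S i) + Fintype.card ι * (ε / (Fintype.card ι + 1)) := by
      simp [Finset.sum_add_distrib]
    _ ≤ ∑ i, sInf (g i '' S i) + ε := by
      gcongr
      rw [mul_div_assoc', div_le_iff₀ (by positivity)]
      nlinarith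

/-- Decomposition lemma for stochastic dynamic programming (hazard-decision setting):
for `N` subsystems with independent dynamics, costs and admissible sets, coupled only through
the (possibly correlated) local noises `w_i` and a shared noise `z`, the global Bellman
functions are additive: `V_t(x) = Σ_i V_t^i(x_i)` for every `t` and every state `x`. -/
theorem bellman_additive_decomposition
    (N T : ℕ) (hN : 1 ≤ N) (hT : 1 ≤ T)
    (X Uc W : Fin N → Type*) (Z : Type*)
    [∀ i, MeasurableSpace (W i)] [MeasurableSpace Z]
    {Ω : Type*} [MeasurableSpace Ω] (μ : Measure Ω) [IsProbabilityMeasure μ]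
    (w : (i : Fin N) → Ω → W i) (hw : ∀ i, Measurable (w i))
    (z : Ω → Z) (hz : Measurable z)
    (C : ℕ → (i : Fin N) → X i → Uc i → W i → Z → ℝ)
    (f : ℕ → (i : Fin N) → X i → Uc i → W i → Z → X i)
    (A : ℕ → (i : Fin N) → X i → W i → Z → Set (Uc i))
    (K : (i : Fin N) → X i → ℝ)
    -- local Bellman functions
    (Vloc : (i : Fin N) → ℕ → X i → ℝ)
    (hVlocT : ∀ i x, Vloc i T x = K i x)
    (hVloc : ∀ i, ∀ t < T, ∀ x, Vloc i t x =
      ∫ ω, sInf ((fun u => C t i x u (w i ω) (z ω)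
        + Vloc i (t + 1) (f t i x u (w i ω) (z ω))) '' A t i x (w i ω) (z ω)) ∂μ)
    -- global Bellman functions
    (Vglob : ℕ → ((i : Fin N) → X i) → ℝ)
    (hVglobT : ∀ x, Vglob T x = ∑ i, K i (x i))
    (hVglob : ∀ t < T, ∀ x, Vglob t x =
      ∫ ω, sInf ((fun u : (i : Fin N) → Uc i =>
          (∑ i, C t i (x i) (u i) (w i ω) (z ω))
            + Vglob (t + 1) (fun i => f t i (x i) (u i) (w i ω) (z ω)))
        '' Set.pi Set.univ (fun i => A t i (x i) (w i ω) (z ω))) ∂μ)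
    -- (a) a.e. nonemptiness of the admissible sets and boundedness below
    (hbdd : ∀ t < T, ∀ i, ∀ x : X i, ∀ᵐ ω ∂μ,
      (A t i x (w i ω) (z ω)).Nonempty ∧
        BddBelow ((fun u => C t i x u (w i ω) (z ω)
          + Vloc i (t + 1) (f t i x u (w i ω) (z ω))) '' A t i x (w i ω) (z ω)))
    -- (b) integrability of the local infima
    (hint : ∀ t < T, ∀ i, ∀ x : X i,
      Integrable (fun ω => sInf ((fun u => C t i x u (w i ω) (z ω)
        + Vloc i (t + 1) (f t i x u (w i ω) (z ω))) '' A t i x (w i ω) (z ω))) μ) :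
    ∀ t ≤ T, ∀ x : (i : Fin N) → X i, Vglob t x = ∑ i, Vloc i t (x i) := by
  intro t ht
  induction ht using Nat.decreasingInduction with
  | self => intro x; simp only [hVglobT, hVlocT]
  | of_succ t ht ih =>
    intro x
    rw [hVglob t ht, Finset.sum_congr rfl fun i _ => hVloc i t ht (x i),
      ← integral_finsetSum _ fun i _ => hint t ht i (x i)]
    refine integral_congr_ae ?_
    filter_upwards [ae_all_iff.2 fun i => hbdd t ht i (x i)] with ω hω
    simp only [ih, ← Finset.sum_add_distrib]
    exact sInf_image_univ_pi_sum
      (fun i u => C t i (x i) u (w i ω) (z ω) + Vloc i (t + 1) (f t i (x i) u (w i ω) (z ω)))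
      _ (fun i => (hω i).1) (fun i => (hω i).2)
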